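/- Fix real constants x₀, y₀ and define x, y : ℝ → ℝ by y t = 3 * t + y₀ and x t = x₀ * Real.exp (3 * t^2 / 2 + y₀ * t). Then for every t ∈ ℝ, the function λ t. (x t, y t) : ℝ → ℝ × ℝ has vector derivative (x t * y t, 3) at t; i.e., (x, y) solves the SODE (ẋ, ẏ) = (x·y, 3). -/

import Mathlib

theorem xy_sode_solution (x₀ y₀ : ℝ) (x y : ℝ → ℝ)
    (hy : ∀ t, y t = 3 * t + y₀)
    (hx : ∀ t, x t = x₀ * Real.exp (3 * t^2 / 2 + y₀ * t)) :
    ∀ t : ℝ, HasDerivAt (fun t => (x t, y t)) (x t * y t, 3) t := by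
  intro t
  obtain rfl : x = fun t => x₀ * Real.exp (3 * t^2 / 2 + y₀ * t) := funext hx
  obtain rfl : y = fun t => 3 * t + y₀ := funext hy
  have h_exponent : HasDerivAt (fun t : ℝ => 3 * t^2 / 2 + y₀ * t) (3 * t + y₀) t := by
    refine ((((hasDerivAt_id' t).fun_pow 2).const_mul 3).div_const 2 |>.fun_add
      ((hasDerivAt_id' t).const_mul y₀)).congr_deriv ?_
    norm_num
    ring
  have h_fst : HasDerivAt (fun t : ℝ => x₀ * Real.exp (3 * t^2 / 2 + y₀ * t))
      (x₀ * Real.exp (3 * t^2 / 2 + y₀ * t) * (3 * t + y₀)) t := by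
    simpa only [mul_assoc] using h_exponent.exp.const_mul x₀
  have h_snd : HasDerivAt (fun t : ℝ => 3 * t + y₀) 3 t := by
    simpa using ((hasDerivAt_id' t).const_mul 3).add_const y₀
  exact h_fst.prodMk h_snd
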